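/- arXiv:2005.01640 — 3 statements merged into one kernel-verified Lean document; each statement's English description precedes it below -/
import Mathlib

section
/- Under Assumption 3.1 (compact metric space model), for each DM i the sample-path cost map (s^i, Z) ↦ J^i(s^i, Z) is jointly continuous and bounded on S^i × Y^{[0,T)} (with S^i = ×_{t<T} S_t^i carrying the product topology of the uniform metrics and Y^{[0,T)} carrying the product topology). In particular, when T = ∞, for every ε > 0 there exists T_ε ∈ ℕ such that the total discounted cost incurred over the horizon t ∈ [T_ε, ∞) under any (s^i, Z) ∈ S^i × Y^{[0,∞)} is smaller than ε in absolute value. -/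
/-
STATEMENT 17.  Under Assumption 3.1 (compact metric space model), for each DM `i` the
sample-path cost map `(sᶦ, Z) ↦ Jᶦ(sᶦ, Z)` is jointly continuous and bounded on
`Sᶦ × Y^ℕ`, where `Sᶦ = ×_t S_tᶦ` carries the product topology of the uniform metrics
(compact-open topology on each factor of continuous maps, whose domain is compact) and
`Y^ℕ` the product topology.  In particular, when the horizon is infinite, for every
`ε > 0` there exists `Tε ∈ ℕ` such that the expected total discounted cost incurred over
the horizon `t ∈ [Tε, ∞)` under any `(sᶦ, Z)` is smaller than `ε` in absolute value.

Here `Jᶦ(sᶦ, Z) = E[∑_t (βᶦ)^t c_tᶦ(x_tᶦ, u_tᶦ, z_t)]`, where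
`x_{t+1}ᶦ = f_tᶦ(x_tᶦ, u_tᶦ, z_t, w_tᶦ)`, `u_tᶦ = s_tᶦ(I_tᶦ, Z_{t-1})`, the expectation
being over DM `i`'s random initial state and disturbances with law `μ i`.  Time runs over
`ℕ`, which subsumes every horizon `T ∈ ℕ ∪ {∞}` of the paper (a finite horizon and its
terminal cost are recovered by stage costs vanishing beyond the horizon).
-/

open MeasureTheory

namespace SEBEU17

/-- Information of a DM at time `t`. -/
abbrev Hist (X U Y : Type) (t : ℕ) : Type :=
  (Fin (t + 1) → X) × (Fin t → U) × (Fin t → Y)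

variable {N : ℕ}
variable (X : Fin N → Type) (U : Fin N → Type) (W : Fin N → Type) (Y : Type)
variable [∀ i, TopologicalSpace (X i)] [∀ i, TopologicalSpace (U i)] [TopologicalSpace Y]

/-- Pure strategy space of DM `i`. -/
abbrev Strat (Sset : ∀ i : Fin N, ∀ t : ℕ, Set C(Hist (X i) (U i) Y t, U i)) (i : Fin N) :
    Type :=
  ∀ t : ℕ, ↥(Sset i t)

variable {X U W Y}
variable {Sset : ∀ i : Fin N, ∀ t : ℕ, Set C(Hist (X i) (U i) Y t, U i)}

/-- DM `i`'s state–control history under strategy `si` against a fixed deterministic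
environment sequence `Z`, for the realization `ωi = (x₀ᶦ, (w_tᶦ))` of its own primitive
random variables. -/
noncomputable def subjHist (f : ∀ i : Fin N, ℕ → X i → U i → Y → W i → X i) (i : Fin N)
    (si : Strat X U Y Sset i) (Z : ℕ → Y) (ωi : X i × (ℕ → W i)) :
    (t : ℕ) → (Fin (t + 1) → X i) × (Fin t → U i)
  | 0 => (fun _ => ωi.1, Fin.elim0)
  | t + 1 =>
      let h := subjHist f i si Z ωi t
      let u : U i := (si t).val ⟨h.1, h.2, fun k : Fin t => Z k⟩
      (Fin.snoc h.1 (f i t (h.1 (Fin.last t)) u (Z t) (ωi.2 t)), Fin.snoc h.2 u)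

/-- Subjective cost `Jᶦ(sᶦ, Z)`. -/
noncomputable def subjCost [∀ i, MeasurableSpace (X i)] [∀ i, MeasurableSpace (W i)]
    (μ : ∀ i : Fin N, Measure (X i × (ℕ → W i)))
    (f : ∀ i : Fin N, ℕ → X i → U i → Y → W i → X i)
    (c : ∀ i : Fin N, ℕ → X i → U i → Y → ℝ) (β : Fin N → ℝ)
    (i : Fin N) (si : Strat X U Y Sset i) (Z : ℕ → Y) : ℝ :=
  ∫ ωi, (∑' t : ℕ, β i ^ t *
      c i t ((subjHist f i si Z ωi t).1 (Fin.last t))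
            ((subjHist f i si Z ωi (t + 1)).2 (Fin.last t)) (Z t)) ∂(μ i)

section Continuity

variable [∀ i, TopologicalSpace (W i)] [∀ i, CompactSpace (X i)] [∀ i, CompactSpace (U i)]
  [CompactSpace Y] [∀ i, T2Space (U i)]

/-- The history at time `t` together with the environment prefix is the argument of the
strategy; the resulting control depends continuously on strategy, environment and noise as
soon as the history does. -/
theorem continuous_control_of_hist {f : ∀ i : Fin N, ℕ → X i → U i → Y → W i → X i} {i : Fin N}
    {t : ℕ}
    (h : Continuous fun q : (Strat X U Y Sset i × (ℕ → Y)) × (X i × (ℕ → W i)) =>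
      subjHist f i q.1.1 q.1.2 q.2 t) :
    Continuous fun q : (Strat X U Y Sset i × (ℕ → Y)) × (X i × (ℕ → W i)) =>
      (q.1.1 t).val ((subjHist f i q.1.1 q.1.2 q.2 t).1, (subjHist f i q.1.1 q.1.2 q.2 t).2,
        fun k : Fin t => q.1.2 k) := by
  have hs : Continuous fun q : (Strat X U Y Sset i × (ℕ → Y)) × (X i × (ℕ → W i)) =>
      (q.1.1 t).val := by fun_prop
  exact hs.eval (h.fst.prodMk (h.snd.prodMk (by fun_prop)))

/-- The state-control history is jointly continuous in strategy, environment and noise. -/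
theorem continuous_subjHist {f : ∀ i : Fin N, ℕ → X i → U i → Y → W i → X i} {i : Fin N}
    (hf : ∀ t, Continuous fun p : X i × U i × Y × W i => f i t p.1 p.2.1 p.2.2.1 p.2.2.2)
    (t : ℕ) :
    Continuous fun q : (Strat X U Y Sset i × (ℕ → Y)) × (X i × (ℕ → W i)) =>
      subjHist f i q.1.1 q.1.2 q.2 t := by
  induction t with
  | zero =>
    simp only [subjHist]
    fun_prop
  | succ t ih =>
    have hu := continuous_control_of_hist ih
    have hx : Continuous fun q : (Strat X U Y Sset i × (ℕ → Y)) × (X i × (ℕ → W i)) =>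
        (subjHist f i q.1.1 q.1.2 q.2 t).1 (Fin.last t) :=
      (continuous_apply (Fin.last t)).comp ih.fst
    have hw : Continuous fun q : (Strat X U Y Sset i × (ℕ → Y)) × (X i × (ℕ → W i)) =>
        (q.1.2 t, q.2.2 t) := by fun_prop
    simp only [subjHist]
    exact (ih.fst.finSnoc ((hf t).comp (hx.prodMk (hu.prodMk hw)))).prodMk (ih.snd.finSnoc hu)

/-- The discounted stage cost is jointly continuous in strategy, environment and noise. -/
theorem continuous_stageCost {f : ∀ i : Fin N, ℕ → X i → U i → Y → W i → X i}
    {c : ∀ i : Fin N, ℕ → X i → U i → Y → ℝ} {i : Fin N}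
    (hf : ∀ t, Continuous fun p : X i × U i × Y × W i => f i t p.1 p.2.1 p.2.2.1 p.2.2.2)
    (hc : ∀ t, Continuous fun p : X i × U i × Y => c i t p.1 p.2.1 p.2.2) (b : ℝ) (t : ℕ) :
    Continuous fun q : (Strat X U Y Sset i × (ℕ → Y)) × (X i × (ℕ → W i)) =>
      b ^ t * c i t ((subjHist f i q.1.1 q.1.2 q.2 t).1 (Fin.last t))
        ((subjHist f i q.1.1 q.1.2 q.2 (t + 1)).2 (Fin.last t)) (q.1.2 t) := by
  have hx : Continuous fun q : (Strat X U Y Sset i × (ℕ → Y)) × (X i × (ℕ → W i)) =>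
      (subjHist f i q.1.1 q.1.2 q.2 t).1 (Fin.last t) :=
    (continuous_apply (Fin.last t)).comp (continuous_subjHist hf t).fst
  have hu : Continuous fun q : (Strat X U Y Sset i × (ℕ → Y)) × (X i × (ℕ → W i)) =>
      (subjHist f i q.1.1 q.1.2 q.2 (t + 1)).2 (Fin.last t) :=
    (continuous_apply (Fin.last t)).comp (continuous_subjHist hf (t + 1)).snd
  have hz : Continuous fun q : (Strat X U Y Sset i × (ℕ → Y)) × (X i × (ℕ → W i)) =>
      q.1.2 t := by fun_prop
  exact continuous_const.mul ((hc t).comp (hx.prodMk (hu.prodMk hz)))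

end Continuity

/-- The integral of the tail of a series dominated by a geometric series. -/
theorem abs_integral_tsum_tail_le {Ω : Type*} [MeasurableSpace Ω] (P : Measure Ω)
    [IsProbabilityMeasure P] (g : ℕ → Ω → ℝ) {r K : ℝ} (hr0 : 0 ≤ r) (hr1 : r < 1)
    (hg : ∀ t ω, |g t ω| ≤ K * r ^ t) (n : ℕ) :
    |∫ ω, (∑' t, if n ≤ t then g t ω else 0) ∂P| ≤ K * r ^ n * (1 - r)⁻¹ := by
  have hgeom := (hasSum_geometric_of_lt_one hr0 hr1).mul_left (K * r ^ n)
  have htail : ∀ ω, ‖∑' t, if n ≤ t then g t ω else 0‖ ≤ K * r ^ n * (1 - r)⁻¹ := by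
    intro ω
    have hsum : Summable fun t => if n ≤ t then g t ω else 0 := by
      refine Summable.of_norm_bounded
        (((hasSum_geometric_of_lt_one hr0 hr1).mul_left K).summable) fun t => ?_
      split_ifs
      · exact hg t ω
      · simpa using (abs_nonneg _).trans (hg t ω)
    have hshift : ∑' t, (if n ≤ t then g t ω else 0) = ∑' t, g (t + n) ω := by
      rw [← hsum.sum_add_tsum_nat_add n, Finset.sum_eq_zero, zero_add]
      · simp
      · intro t ht
        simp [Finset.mem_range.mp ht]
    rw [hshift]
    refine tsum_of_norm_bounded hgeom fun t => (hg (t + n) ω).trans (le_of_eq ?_)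
    ring
  simpa using norm_integral_le_of_norm_le_const (μ := P) (Filter.Eventually.of_forall htail)

end SEBEU17

open SEBEU17 in
/-- continuity and boundedness of the sample-path cost map, with a uniform
tail bound in the infinite-horizon case, under Assumption 3.1. -/
theorem subjCost_continuous_bounded_tail
    {N : ℕ}
    (X : Fin N → Type) (U : Fin N → Type) (W : Fin N → Type) (Y : Type)
    [∀ i, MetricSpace (X i)] [∀ i, CompactSpace (X i)] [∀ i, Nonempty (X i)]
    [∀ i, MetricSpace (U i)] [∀ i, CompactSpace (U i)] [∀ i, Nonempty (U i)]
    [∀ i, MetricSpace (W i)] [∀ i, CompactSpace (W i)] [∀ i, Nonempty (W i)]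
    [MetricSpace Y] [CompactSpace Y] [Nonempty Y]
    [∀ i, MeasurableSpace (X i)] [∀ i, BorelSpace (X i)]
    [∀ i, MeasurableSpace (W i)] [∀ i, BorelSpace (W i)]
    (f : ∀ i : Fin N, ℕ → X i → U i → Y → W i → X i)
    (c : ∀ i : Fin N, ℕ → X i → U i → Y → ℝ)
    (hf : ∀ i t, Continuous fun p : X i × U i × Y × W i => f i t p.1 p.2.1 p.2.2.1 p.2.2.2)
    (hc : ∀ i t, Continuous fun p : X i × U i × Y => c i t p.1 p.2.1 p.2.2)
    (Sset : ∀ i : Fin N, ∀ t : ℕ, Set C(Hist (X i) (U i) Y t, U i))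
    (hScpt : ∀ i t, IsCompact (Sset i t)) (hSne : ∀ i t, (Sset i t).Nonempty)
    (β : Fin N → ℝ) (cbar βbar : ℝ)
    (hcb : ∀ i t x u y, |c i t x u y| ≤ cbar)
    (hβ0 : ∀ i, 0 ≤ β i) (hβb : ∀ i, β i ≤ βbar) (hβbar : βbar < 1)
    (μ : ∀ i : Fin N, Measure (X i × (ℕ → W i))) [∀ i, IsProbabilityMeasure (μ i)] :
    -- joint continuity of `(sᶦ, Z) ↦ Jᶦ(sᶦ, Z)` on `Sᶦ × Y^ℕ`
    (∀ i : Fin N, Continuous fun p : Strat X U Y Sset i × (ℕ → Y) =>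
      subjCost μ f c β i p.1 p.2) ∧
    -- boundedness, uniformly over all DMs, strategies and environment sequences
    (∃ M : ℝ, ∀ (i : Fin N) (si : Strat X U Y Sset i) (Z : ℕ → Y),
      |subjCost μ f c β i si Z| ≤ M) ∧
    -- uniform tail bound: the expected discounted cost over `t ∈ [Tε, ∞)` is `< ε`
    (∀ ε : ℝ, 0 < ε → ∃ Tε : ℕ,
      ∀ (i : Fin N) (si : Strat X U Y Sset i) (Z : ℕ → Y),
        |∫ ωi, (∑' t : ℕ, if Tε ≤ t then
            β i ^ t * c i t ((subjHist f i si Z ωi t).1 (Fin.last t))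
              ((subjHist f i si Z ωi (t + 1)).2 (Fin.last t)) (Z t)
          else 0) ∂(μ i)| < ε) := by
  obtain ⟨r, hr0, hr1, hβr⟩ : ∃ r : ℝ, 0 ≤ r ∧ r < 1 ∧ ∀ i, β i ≤ r :=
    ⟨max βbar 0, le_max_right _ _, max_lt hβbar one_pos, fun i => (hβb i).trans (le_max_left _ _)⟩
  obtain ⟨K, hK⟩ : ∃ K : ℝ, K = |cbar| := ⟨_, rfl⟩
  have hbound : ∀ (i : Fin N) (t : ℕ) (x : X i) (u : U i) (y : Y),
      |β i ^ t * c i t x u y| ≤ K * r ^ t := by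
    intro i t x u y
    rw [abs_mul, abs_of_nonneg (pow_nonneg (hβ0 i) t), mul_comm, hK]
    exact mul_le_mul ((hcb i t x u y).trans (le_abs_self _))
      (pow_le_pow_left₀ (hβ0 i) (hβr i) t) (pow_nonneg (hβ0 i) t) (abs_nonneg _)
  have hgeom := (hasSum_geometric_of_lt_one hr0 hr1).mul_left K
  refine ⟨fun i => ?_, ⟨K * r ^ 0 * (1 - r)⁻¹, fun i si Z => ?_⟩, fun ε hε => ?_⟩
  · have hjoint := continuous_tsum
      (fun t => continuous_stageCost (Sset := Sset) (hf i) (hc i) (β i) t) hgeom.summable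
      (fun t q => hbound i t _ _ _)
    unfold subjCost
    refine continuous_of_dominated (bound := fun _ => K * (1 - r)⁻¹) (fun p => ?_)
      (fun p => Filter.Eventually.of_forall fun ω => ?_) (integrable_const _)
      (Filter.Eventually.of_forall fun ω => ?_)
    · exact (hjoint.comp (Continuous.prodMk_right p)).aestronglyMeasurable
    · exact tsum_of_norm_bounded hgeom fun t => hbound i t _ _ _
    · exact hjoint.comp (Continuous.prodMk_left ω)
  · simpa [subjCost] using abs_integral_tsum_tail_le (μ i)
      (fun t ωi => β i ^ t * c i t ((subjHist f i si Z ωi t).1 (Fin.last t))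
        ((subjHist f i si Z ωi (t + 1)).2 (Fin.last t)) (Z t)) hr0 hr1
      (fun t ωi => hbound i t _ _ _) 0
  · have hlim : Filter.Tendsto (fun n : ℕ => K * r ^ n * (1 - r)⁻¹) Filter.atTop (nhds 0) := by
      simpa using ((tendsto_pow_atTop_nhds_zero_of_lt_one hr0 hr1).const_mul K).mul_const (1 - r)⁻¹
    obtain ⟨n, hn⟩ := (hlim.eventually_lt_const hε).exists
    exact ⟨n, fun i si Z => (abs_integral_tsum_tail_le (μ i)
      (fun t ωi => β i ^ t * c i t ((subjHist f i si Z ωi t).1 (Fin.last t))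
        ((subjHist f i si Z ωi (t + 1)).2 (Fin.last t)) (Z t)) hr0 hr1
      (fun t ωi => hbound i t _ _ _) n).trans_lt hn⟩
end

section
/- Under Assumption 4.1 (large games with aggregate-statistic-driven environment), the subjective and objective costs become uniformly close as the number of players grows: lim_{N→∞} sup_{i∈[1,N], γ̃^i∈Γ^i, γ∈Γ} |E^{(γ̃^i, ζ_γ)}[J^i] − E^{(γ̃^i, γ^{−i})}[J̄^{i,N}]| = 0, where E^{(γ̃^i, ζ_γ)}[J^i] is DM i's expected cost in G^N when it plays the mixed strategy γ̃^i against the environment process treated as an independent exogenous sequence with the distribution ζ_γ induced by γ, and E^{(γ̃^i, γ^{−i})}[J̄^{i,N}] is DM i's actual expected cost in G^N when it plays γ̃^i and the other DMs play γ^{−i}. -/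
/-
STATEMENT 18.  In large games with aggregate-statistic-driven environment
(Assumption 4.1), the subjective and objective costs become uniformly close as the number
of players grows:

  lim_{N→∞} sup_{i ∈ [1,N], γ̃ᶦ ∈ Γᶦ, γ ∈ Γ}
    |E^{(γ̃ᶦ, ζ_γ)}[Jᶦ] − E^{(γ̃ᶦ, γ^{-i})}[J̄^{i,N}]| = 0 ,

i.e. for every `ε > 0` there is `N0` such that for all `N ≥ N0`, all DMs `i`, all mixed
strategies `γ̃ᶦ` and all joint mixed strategies `γ` in `G^N`, the expected subjective cost
of DM `i` playing `γ̃ᶦ` against the environment process treated as an independent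
exogenous sequence with the endogenous distribution `ζ_γ`, and DM `i`'s actual expected
cost when it plays `γ̃ᶦ` and the other DMs play `γ^{-i}`, differ by at most `ε`.

Model and Assumption 4.1 exactly as in the paper: all DMs share compact metric
state/control/disturbance spaces and the common compact strategy constraint sets; dynamics
and costs are continuous, with the families `(c_tᶦ)ᵢ`, `(f_tᶦ)ᵢ` uniformly
equicontinuous; stage costs are uniformly bounded and discount factors uniformly below
one; the environment depends on the players only through the aggregate statistics
`d_t^N ∈ D`, which have negligible sensitivity (`hd1`) and vanishing single-player
influence (`hd2`); the primitive random variables `ω⁰, ω¹, ω², …` are mutually independent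
(built into `jointLaw`).  Time runs over `ℕ`, subsuming every horizon `T ∈ ℕ ∪ {∞}`.
-/

open MeasureTheory

namespace SEBEULarge

/-- Borel σ-algebra on a space of continuous maps. -/
noncomputable instance instMeasurableSpaceContinuousMap (A B : Type)
    [TopologicalSpace A] [TopologicalSpace B] : MeasurableSpace C(A, B) := borel _

/-- Information of a DM at time `t`. -/
abbrev Hist (X U Y : Type) (t : ℕ) : Type :=
  (Fin (t + 1) → X) × (Fin t → U) × (Fin t → Y)

variable (X U W X0 W0 Ξ Y D : Type)
variable [TopologicalSpace X] [TopologicalSpace U] [TopologicalSpace Y]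

/-- The common pure strategy space of every DM (Assumption 4.1). -/
abbrev Strat (Sset : ∀ t : ℕ, Set C(Hist X U Y t, U)) : Type := ∀ t : ℕ, ↥(Sset t)

/-- Joint history in the game `G^N` at time `t`. -/
abbrev SysHist (N : ℕ) (t : ℕ) : Type :=
  (Fin N → (Fin (t + 1) → X) × (Fin t → U)) × (Fin t → Y) × X0

/-- Environment primitive random variables `ω⁰ = (x₀⁰, (w_t⁰), (ξ_t))`. -/
abbrev Prim0 : Type := X0 × (ℕ → W0) × (ℕ → Ξ)

/-- DM-local primitive random variables `ωᶦ = (x₀ᶦ, (w_tᶦ))`. -/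
abbrev PrimLoc : Type := X × (ℕ → W)

variable {X U W X0 W0 Ξ Y D}
variable {Sset : ∀ t : ℕ, Set C(Hist X U Y t, U)}

/-- Closed-loop joint history in `G^N` under the pure strategy profile `s`:
`u_tᶦ = s_tᶦ(I_tᶦ, Y_{t-1})`, `d_t = d_t^N(x_t, u_t)`, `y_t = g_t(x_t⁰, d_t, ξ_t)`,
`x_{t+1}⁰ = f_t⁰(x_t⁰, d_t, w_t⁰)`, `x_{t+1}ᶦ = f_tᶦ(x_tᶦ, u_tᶦ, y_t, w_tᶦ)`. -/
noncomputable def sysHist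
    (f : ℕ → ℕ → X → U → Y → W → X)
    (dstat : (N : ℕ) → ℕ → (Fin N → X) → (Fin N → U) → D)
    (g : ℕ → X0 → D → Ξ → Y) (f0 : ℕ → X0 → D → W0 → X0)
    {N : ℕ} (s : Fin N → Strat X U Y Sset)
    (ω : Prim0 X0 W0 Ξ × (Fin N → PrimLoc X W)) :
    (t : ℕ) → SysHist X U X0 Y N t
  | 0 => (fun i => (fun _ => (ω.2 i).1, Fin.elim0), Fin.elim0, ω.1.1)
  | t + 1 =>
      let h := sysHist f dstat g f0 s ω t
      let xcur : Fin N → X := fun i => (h.1 i).1 (Fin.last t)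
      let u : Fin N → U := fun i => (s i t).val ⟨(h.1 i).1, (h.1 i).2, h.2.1⟩
      let d : D := dstat N t xcur u
      let y : Y := g t h.2.2 d (ω.1.2.2 t)
      (fun i => (Fin.snoc (h.1 i).1 (f i t (xcur i) (u i) y ((ω.2 i).2 t)),
                 Fin.snoc (h.1 i).2 (u i)),
       Fin.snoc h.2.1 y,
       f0 t h.2.2 d (ω.1.2.1 t))

/-- Realized environment path in `G^N` under the profile `s`. -/
noncomputable def yPath
    (f : ℕ → ℕ → X → U → Y → W → X)
    (dstat : (N : ℕ) → ℕ → (Fin N → X) → (Fin N → U) → D)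
    (g : ℕ → X0 → D → Ξ → Y) (f0 : ℕ → X0 → D → W0 → X0)
    {N : ℕ} (s : Fin N → Strat X U Y Sset)
    (ω : Prim0 X0 W0 Ξ × (Fin N → PrimLoc X W)) : ℕ → Y :=
  fun t => (sysHist f dstat g f0 s ω (t + 1)).2.1 (Fin.last t)

/-- DM `i`'s state–control history under strategy `si` against a fixed deterministic
environment sequence `Z` (independent of `N`). -/
noncomputable def subjHist (f : ℕ → ℕ → X → U → Y → W → X) (i : ℕ)
    (si : Strat X U Y Sset) (Z : ℕ → Y) (ωi : PrimLoc X W) :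
    (t : ℕ) → (Fin (t + 1) → X) × (Fin t → U)
  | 0 => (fun _ => ωi.1, Fin.elim0)
  | t + 1 =>
      let h := subjHist f i si Z ωi t
      let u : U := (si t).val ⟨h.1, h.2, fun k : Fin t => Z k⟩
      (Fin.snoc h.1 (f i t (h.1 (Fin.last t)) u (Z t) (ωi.2 t)), Fin.snoc h.2 u)

section Meas

variable [MeasurableSpace X] [MeasurableSpace U] [MeasurableSpace X0]
    [MeasurableSpace W0] [MeasurableSpace W] [MeasurableSpace Y] [MeasurableSpace Ξ]
variable (μ0 : Measure (Prim0 X0 W0 Ξ)) (μloc : ℕ → Measure (PrimLoc X W))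
variable [IsProbabilityMeasure μ0] [∀ i, IsProbabilityMeasure (μloc i)]

/-- Joint law of all primitive random variables in `G^N`: the mutually independent product
of `μ0` and the local laws `μloc i`, `i < N` (Assumption 4.1, Condition 3). -/
noncomputable def jointLaw (N : ℕ) : Measure (Prim0 X0 W0 Ξ × (Fin N → PrimLoc X W)) :=
  μ0.prod (Measure.pi fun i : Fin N => μloc i)

/-- Subjective cost `Jᶦ(sᶦ, Z)` of DM `i` (the same function in every game containing
DM `i`). -/
noncomputable def subjCost
    (f : ℕ → ℕ → X → U → Y → W → X) (c : ℕ → ℕ → X → U → Y → ℝ) (β : ℕ → ℝ)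
    (i : ℕ) (si : Strat X U Y Sset) (Z : ℕ → Y) : ℝ :=
  ∫ ωi, (∑' t : ℕ, β i ^ t *
      c i t ((subjHist f i si Z ωi t).1 (Fin.last t))
            ((subjHist f i si Z ωi (t + 1)).2 (Fin.last t)) (Z t)) ∂(μloc i)

/-- Expected subjective cost `E^{(γ̃ᶦ, ζ)}[Jᶦ]` of DM `i` under the mixed strategy `γ̃ᶦ`
and an independent exogenous environment distribution `ζ`. -/
noncomputable def expSubjCost
    (f : ℕ → ℕ → X → U → Y → W → X) (c : ℕ → ℕ → X → U → Y → ℝ) (β : ℕ → ℝ)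
    (i : ℕ) (γi : ProbabilityMeasure (Strat X U Y Sset)) (ζ : Measure (ℕ → Y)) : ℝ :=
  ∫ si, ∫ Z, subjCost μloc f c β i si Z ∂ζ ∂(γi : Measure (Strat X U Y Sset))

/-- Environment distribution `ζ_γ` induced endogenously in `G^N` by the joint mixed
strategy `γ`. -/
noncomputable def envLawMixed
    (f : ℕ → ℕ → X → U → Y → W → X)
    (dstat : (N : ℕ) → ℕ → (Fin N → X) → (Fin N → U) → D)
    (g : ℕ → X0 → D → Ξ → Y) (f0 : ℕ → X0 → D → W0 → X0)
    (N : ℕ) (γ : Fin N → ProbabilityMeasure (Strat X U Y Sset)) : Measure (ℕ → Y) :=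
  (Measure.pi fun j => (γ j : Measure (Strat X U Y Sset))).bind
    (fun s => Measure.map (yPath f dstat g f0 s) (jointLaw μ0 μloc N))

/-- Actual (objective) long-term cost `J̄^{i,N}(s)` of DM `i` in `G^N` under the pure
strategy profile `s`. -/
noncomputable def objCost
    (f : ℕ → ℕ → X → U → Y → W → X)
    (dstat : (N : ℕ) → ℕ → (Fin N → X) → (Fin N → U) → D)
    (g : ℕ → X0 → D → Ξ → Y) (f0 : ℕ → X0 → D → W0 → X0)
    (c : ℕ → ℕ → X → U → Y → ℝ) (β : ℕ → ℝ)
    {N : ℕ} (i : Fin N) (s : Fin N → Strat X U Y Sset) : ℝ :=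
  ∫ ω, (∑' t : ℕ, β i.val ^ t *
      c i.val t (((sysHist f dstat g f0 s ω t).1 i).1 (Fin.last t))
                (((sysHist f dstat g f0 s ω (t + 1)).1 i).2 (Fin.last t))
                ((sysHist f dstat g f0 s ω (t + 1)).2.1 (Fin.last t))) ∂(jointLaw μ0 μloc N)

/-- Expected objective cost `E^{γ}[J̄^{i,N}]` of DM `i` in `G^N` under the joint mixed
strategy `γ`. -/
noncomputable def expObjCost
    (f : ℕ → ℕ → X → U → Y → W → X)
    (dstat : (N : ℕ) → ℕ → (Fin N → X) → (Fin N → U) → D)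
    (g : ℕ → X0 → D → Ξ → Y) (f0 : ℕ → X0 → D → W0 → X0)
    (c : ℕ → ℕ → X → U → Y → ℝ) (β : ℕ → ℝ)
    {N : ℕ} (i : Fin N) (γ : Fin N → ProbabilityMeasure (Strat X U Y Sset)) : ℝ :=
  ∫ s, objCost μ0 μloc f dstat g f0 c β i s
    ∂(Measure.pi fun j => (γ j : Measure (Strat X U Y Sset)))

end Meas

end SEBEULarge



namespace SEBEULarge

section Deterministic

variable {X U W X0 W0 Ξ Y D : Type}

section Trajectories

variable [TopologicalSpace X] [TopologicalSpace U] [TopologicalSpace Y]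
variable {Sset : ∀ t : ℕ, Set C(Hist X U Y t, U)}
variable {f : ℕ → ℕ → X → U → Y → W → X}
  {dstat : (N : ℕ) → ℕ → (Fin N → X) → (Fin N → U) → D}
  {g : ℕ → X0 → D → Ξ → Y} {f0 : ℕ → X0 → D → W0 → X0}

/-- The environment history stored in `sysHist` is the initial segment of `yPath`. -/
lemma sysHist_env_eq_yPath {N : ℕ} (s : Fin N → Strat X U Y Sset)
    (ω : Prim0 X0 W0 Ξ × (Fin N → PrimLoc X W)) (t : ℕ) :
    (sysHist f dstat g f0 s ω t).2.1 = fun k : Fin t => yPath f dstat g f0 s ω k := by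
  induction t with
  | zero => ext k; exact k.elim0
  | succ t ih =>
    ext k
    refine Fin.lastCases ?_ (fun k => ?_) k
    · rfl
    · have := congrFun ih k
      simpa [sysHist] using this

/-- A DM's own history in the game is its response to the realized environment path. -/
lemma subjHist_yPath {N : ℕ} (s : Fin N → Strat X U Y Sset)
    (ω : Prim0 X0 W0 Ξ × (Fin N → PrimLoc X W)) (i : Fin N) (t : ℕ) :
    subjHist f i (s i) (yPath f dstat g f0 s ω) (ω.2 i) t
      = (sysHist f dstat g f0 s ω t).1 i := by
  induction t with
  | zero => rfl
  | succ t ih =>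
    have hy : yPath f dstat g f0 s ω t = (sysHist f dstat g f0 s ω (t + 1)).2.1 (Fin.last t) := rfl
    simp only [subjHist, ih, ← sysHist_env_eq_yPath s ω t, hy]
    simp [sysHist]

/-- Pathwise discounted cost of DM `i` against the environment sequence `Z`. -/
noncomputable def pathCost (f : ℕ → ℕ → X → U → Y → W → X) (c : ℕ → ℕ → X → U → Y → ℝ)
    (β : ℕ → ℝ) (i : ℕ) (si : Strat X U Y Sset) (Z : ℕ → Y) (ωi : PrimLoc X W) : ℝ :=
  ∑' t : ℕ, β i ^ t *
    c i t ((subjHist f i si Z ωi t).1 (Fin.last t))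
      ((subjHist f i si Z ωi (t + 1)).2 (Fin.last t)) (Z t)

lemma continuous_apply_strat [LocallyCompactSpace X] [LocallyCompactSpace U] [LocallyCompactSpace Y]
    (t : ℕ) :
    Continuous fun p : Strat X U Y Sset × Hist X U Y t => (p.1 t).val p.2 :=
  ((continuous_subtype_val.comp ((continuous_apply t).comp continuous_fst))).eval continuous_snd

lemma continuous_subjHist [LocallyCompactSpace X] [LocallyCompactSpace U] [LocallyCompactSpace Y]
    [TopologicalSpace W] {i : ℕ}
    (hf : ∀ t, Continuous fun p : X × U × Y × W => f i t p.1 p.2.1 p.2.2.1 p.2.2.2) (t : ℕ) :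
    Continuous fun p : Strat X U Y Sset × (ℕ → Y) × PrimLoc X W =>
      subjHist f i p.1 p.2.1 p.2.2 t := by
  induction t with
  | zero => simp only [subjHist]; fun_prop
  | succ t ih =>
    have hu : Continuous fun p : Strat X U Y Sset × (ℕ → Y) × PrimLoc X W =>
        (p.1 t).val ⟨(subjHist f i p.1 p.2.1 p.2.2 t).1, (subjHist f i p.1 p.2.1 p.2.2 t).2,
          fun k : Fin t => p.2.1 k⟩ :=
      (continuous_apply_strat t).comp (continuous_fst.prodMk
        (ih.fst.prodMk (ih.snd.prodMk (by fun_prop))))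
    have hx : Continuous fun p : Strat X U Y Sset × (ℕ → Y) × PrimLoc X W =>
        (subjHist f i p.1 p.2.1 p.2.2 t).1 (Fin.last t) :=
      (continuous_apply _).comp ih.fst
    have hxn := (hf t).comp (hx.prodMk (hu.prodMk
      ((show Continuous fun p : Strat X U Y Sset × (ℕ → Y) × PrimLoc X W => p.2.1 t by
        fun_prop).prodMk
      (show Continuous fun p : Strat X U Y Sset × (ℕ → Y) × PrimLoc X W => p.2.2.2 t by
        fun_prop))))
    exact (ih.fst.finSnoc hxn).prodMk (ih.snd.finSnoc hu)

lemma continuous_sysHist [LocallyCompactSpace X] [LocallyCompactSpace U] [LocallyCompactSpace Y]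
    [TopologicalSpace W] [TopologicalSpace X0] [TopologicalSpace W0] [TopologicalSpace Ξ]
    [TopologicalSpace D]
    (hf : ∀ i t, Continuous fun p : X × U × Y × W => f i t p.1 p.2.1 p.2.2.1 p.2.2.2)
    (hg : ∀ t, Continuous fun p : X0 × D × Ξ => g t p.1 p.2.1 p.2.2)
    (hf0 : ∀ t, Continuous fun p : X0 × D × W0 => f0 t p.1 p.2.1 p.2.2)
    (hd : ∀ N t, Continuous fun p : (Fin N → X) × (Fin N → U) => dstat N t p.1 p.2)
    (N t : ℕ) :
    Continuous fun p : (Fin N → Strat X U Y Sset) × (Prim0 X0 W0 Ξ × (Fin N → PrimLoc X W)) =>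
      sysHist f dstat g f0 p.1 p.2 t := by
  induction t with
  | zero => simp only [sysHist]; fun_prop
  | succ t ih =>
    have hx : ∀ i, Continuous fun p : (Fin N → Strat X U Y Sset) ×
        (Prim0 X0 W0 Ξ × (Fin N → PrimLoc X W)) =>
        ((sysHist f dstat g f0 p.1 p.2 t).1 i).1 := fun i =>
      ((continuous_apply i).comp ih.fst).fst
    have hU : ∀ i, Continuous fun p : (Fin N → Strat X U Y Sset) ×
        (Prim0 X0 W0 Ξ × (Fin N → PrimLoc X W)) =>
        ((sysHist f dstat g f0 p.1 p.2 t).1 i).2 := fun i =>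
      ((continuous_apply i).comp ih.fst).snd
    have hxc : ∀ i, Continuous fun p : (Fin N → Strat X U Y Sset) ×
        (Prim0 X0 W0 Ξ × (Fin N → PrimLoc X W)) =>
        ((sysHist f dstat g f0 p.1 p.2 t).1 i).1 (Fin.last t) := fun i =>
      (continuous_apply _).comp (hx i)
    have hu : ∀ i, Continuous fun p : (Fin N → Strat X U Y Sset) ×
        (Prim0 X0 W0 Ξ × (Fin N → PrimLoc X W)) =>
        (p.1 i t).val ⟨((sysHist f dstat g f0 p.1 p.2 t).1 i).1,
          ((sysHist f dstat g f0 p.1 p.2 t).1 i).2, (sysHist f dstat g f0 p.1 p.2 t).2.1⟩ :=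
      fun i => (continuous_apply_strat t).comp
        (((continuous_apply i).comp continuous_fst).prodMk
          ((hx i).prodMk ((hU i).prodMk ih.snd.fst)))
    have hdc := (hd N t).comp ((continuous_pi hxc).prodMk (continuous_pi hu))
    have hy := (hg t).comp (ih.snd.snd.prodMk (hdc.prodMk
      (show Continuous fun p : (Fin N → Strat X U Y Sset) ×
        (Prim0 X0 W0 Ξ × (Fin N → PrimLoc X W)) => p.2.1.2.2 t by fun_prop)))
    have hx0 := (hf0 t).comp (ih.snd.snd.prodMk (hdc.prodMk
      (show Continuous fun p : (Fin N → Strat X U Y Sset) ×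
        (Prim0 X0 W0 Ξ × (Fin N → PrimLoc X W)) => p.2.1.2.1 t by fun_prop)))
    have hxn : ∀ i : Fin N, Continuous _ := fun i => (hf i t).comp ((hxc i).prodMk
      ((hu i).prodMk (hy.prodMk
        (show Continuous fun p : (Fin N → Strat X U Y Sset) ×
          (Prim0 X0 W0 Ξ × (Fin N → PrimLoc X W)) => (p.2.2 i).2 t by fun_prop))))
    exact (continuous_pi fun i => (Continuous.finSnoc (A := fun _ => X) (hx i) (hxn i)).prodMk
      (Continuous.finSnoc (A := fun _ => U) (hU i) (hu i))).prodMk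
      ((Continuous.finSnoc (A := fun _ => Y) ih.snd.fst hy).prodMk hx0)

end Trajectories

lemma dist_finSnoc_lt {A : Type} [PseudoMetricSpace A] {n : ℕ} {a a' : Fin n → A} {b b' : A}
    {ε : ℝ} (ha : dist a a' < ε) (hb : dist b b' < ε) :
    dist (Fin.snoc a b : Fin (n + 1) → A) (Fin.snoc a' b') < ε := by
  rw [dist_pi_lt_iff (dist_nonneg.trans_lt hb)]
  refine fun k => Fin.lastCases ?_ (fun k => ?_) k
  · simpa using hb
  · simpa using (dist_le_pi_dist a a' k).trans_lt ha

/-- Single-player influence is bounded by its supremum over all unilateral changes. -/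
lemma le_iSup_influence [MetricSpace D] [CompactSpace D] {N : ℕ}
    (F : (Fin N → X) → (Fin N → U) → D) (i : Fin N)
    (x x' : Fin N → X) (u u' : Fin N → U) (h : ∀ j, j ≠ i → x j = x' j ∧ u j = u' j) :
    dist (F x u) (F x' u') ≤
      ⨆ (i : Fin N) (x : Fin N → X) (u : Fin N → U) (x' : Fin N → X) (u' : Fin N → U)
        (_ : ∀ j : Fin N, j ≠ i → x j = x' j ∧ u j = u' j), dist (F x u) (F x' u') := by
  have key : ∀ d d' : D, dist d d' ≤ Metric.diam (Set.univ : Set D) := fun d d' =>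
    Metric.dist_le_diam_of_mem isCompact_univ.isBounded trivial trivial
  have h0 : 0 ≤ Metric.diam (Set.univ : Set D) := Metric.diam_nonneg
  have hin : ∀ i x u x' u', (⨆ (_ : ∀ j : Fin N, j ≠ i → x j = x' j ∧ u j = u' j),
      dist (F x u) (F x' u')) ≤ Metric.diam (Set.univ : Set D) := fun _ _ _ _ _ =>
    Real.iSup_le (fun _ => key _ _) h0
  refine le_ciSup_of_le ⟨_, Set.forall_mem_range.2 fun _ => Real.iSup_le (fun _ => Real.iSup_le
    (fun _ => Real.iSup_le (fun _ => Real.iSup_le (fun _ => hin _ _ _ _ _) h0) h0) h0) h0⟩ i ?_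
  refine le_ciSup_of_le ⟨_, Set.forall_mem_range.2 fun _ => Real.iSup_le
    (fun _ => Real.iSup_le (fun _ => Real.iSup_le (fun _ => hin _ _ _ _ _) h0) h0) h0⟩ x ?_
  refine le_ciSup_of_le ⟨_, Set.forall_mem_range.2 fun _ => Real.iSup_le
    (fun _ => Real.iSup_le (fun _ => hin _ _ _ _ _) h0) h0⟩ u ?_
  refine le_ciSup_of_le ⟨_, Set.forall_mem_range.2 fun _ => Real.iSup_le
    (fun _ => hin _ _ _ _ _) h0⟩ x' ?_
  refine le_ciSup_of_le ⟨_, Set.forall_mem_range.2 fun _ => hin _ _ _ _ _⟩ u' ?_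
  exact le_ciSup_of_le ⟨_, Set.forall_mem_range.2 fun _ => key _ _⟩ h le_rfl

variable [MetricSpace X] [CompactSpace X] [MetricSpace U] [CompactSpace U]
  [MetricSpace W] [MetricSpace Y] [CompactSpace Y]
variable {Sset : ∀ t : ℕ, Set C(Hist X U Y t, U)}
variable {f : ℕ → ℕ → X → U → Y → W → X} {c : ℕ → ℕ → X → U → Y → ℝ} {β : ℕ → ℝ}

/-- Compactness of the strategy set makes its members uniformly equicontinuous. -/
lemma exists_dist_strat_lt (hScpt : ∀ t, IsCompact (Sset t)) (t : ℕ) {ε : ℝ} (hε : 0 < ε) :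
    ∃ δ > 0, ∀ (σ : Sset t) (h h' : Hist X U Y t), dist h h' < δ →
      dist (σ.val h) (σ.val h') < ε := by
  have : CompactSpace (Sset t) := isCompact_iff_compactSpace.1 (hScpt t)
  have hc : Continuous fun p : Sset t × Hist X U Y t => p.1.val p.2 :=
    (continuous_subtype_val.comp continuous_fst).eval continuous_snd
  obtain ⟨δ, hδ, h⟩ := Metric.uniformContinuous_iff.1
    (CompactSpace.uniformContinuous_of_continuous hc) ε hε
  refine ⟨δ, hδ, fun σ a b hab => h (a := (σ, a)) (b := (σ, b)) ?_⟩
  simpa [Prod.dist_eq, hδ] using hab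

lemma exists_dist_subjHist_lt
    (hfEq : ∀ t, UniformEquicontinuous fun (i : ℕ) (p : X × U × Y × W) =>
      f i t p.1 p.2.1 p.2.2.1 p.2.2.2)
    (hScpt : ∀ t, IsCompact (Sset t)) (t : ℕ) :
    ∀ ε > 0, ∃ δ > 0, ∀ (i : ℕ) (si : Strat X U Y Sset) (Z Z' : ℕ → Y) (ωi : PrimLoc X W),
      (∀ k < t, dist (Z k) (Z' k) < δ) →
        dist (subjHist f i si Z ωi t) (subjHist f i si Z' ωi t) < ε := by
  induction t with
  | zero =>
    intro ε hε
    exact ⟨1, one_pos, fun i si Z Z' ωi _ => by simpa [subjHist] using hε⟩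
  | succ t ih =>
    intro ε hε
    obtain ⟨δ₁, hδ₁, h₁⟩ := Metric.uniformEquicontinuous_iff.1 (hfEq t) ε hε
    obtain ⟨δ₂, hδ₂, h₂⟩ := exists_dist_strat_lt hScpt t (lt_min hε hδ₁)
    obtain ⟨δ₃, hδ₃, h₃⟩ := ih (min ε (min δ₁ δ₂)) (by positivity)
    refine ⟨min δ₁ (min δ₂ δ₃), by positivity, fun i si Z Z' ωi hZ => ?_⟩
    have hZ' : ∀ k < t + 1, dist (Z k) (Z' k) < δ₁ ∧ dist (Z k) (Z' k) < δ₂ ∧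
        dist (Z k) (Z' k) < δ₃ := fun k hk => by simpa using hZ k hk
    have hh := h₃ i si Z Z' ωi fun k hk => (hZ' k (by omega)).2.2
    simp only [Prod.dist_eq, max_lt_iff, lt_min_iff] at hh
    obtain ⟨⟨hx, hu⟩, ⟨hx₁, -⟩, hx₂, hu₂⟩ := hh
    have hun := h₂ (si t)
      ⟨(subjHist f i si Z ωi t).1, (subjHist f i si Z ωi t).2, fun k : Fin t => Z k⟩
      ⟨(subjHist f i si Z' ωi t).1, (subjHist f i si Z' ωi t).2, fun k : Fin t => Z' k⟩
      (by
        simp only [Prod.dist_eq, max_lt_iff]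
        exact ⟨hx₂, hu₂, (dist_pi_lt_iff hδ₂).2 fun k => (hZ' k (by omega)).2.1⟩)
    rw [lt_min_iff] at hun
    simp only [subjHist, Prod.dist_eq, max_lt_iff]
    refine ⟨dist_finSnoc_lt hx (h₁ (_, _, _, _) (_, _, _, _) ?_ i), dist_finSnoc_lt hu hun.1⟩
    simp only [Prod.dist_eq, max_lt_iff, dist_self]
    exact ⟨(dist_le_pi_dist _ _ _).trans_lt hx₁, hun.2, (hZ' t (by omega)).1, hδ₁⟩

lemma exists_dist_stageCost_lt
    (hfEq : ∀ t, UniformEquicontinuous fun (i : ℕ) (p : X × U × Y × W) =>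
      f i t p.1 p.2.1 p.2.2.1 p.2.2.2)
    (hcEq : ∀ t, UniformEquicontinuous fun (i : ℕ) (p : X × U × Y) => c i t p.1 p.2.1 p.2.2)
    (hScpt : ∀ t, IsCompact (Sset t)) (t : ℕ) {ε : ℝ} (hε : 0 < ε) :
    ∃ δ > 0, ∀ (i : ℕ) (si : Strat X U Y Sset) (Z Z' : ℕ → Y) (ωi : PrimLoc X W),
      (∀ k < t + 1, dist (Z k) (Z' k) < δ) →
        dist (c i t ((subjHist f i si Z ωi t).1 (Fin.last t))
            ((subjHist f i si Z ωi (t + 1)).2 (Fin.last t)) (Z t))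
          (c i t ((subjHist f i si Z' ωi t).1 (Fin.last t))
            ((subjHist f i si Z' ωi (t + 1)).2 (Fin.last t)) (Z' t)) < ε := by
  obtain ⟨δ₁, hδ₁, h₁⟩ := Metric.uniformEquicontinuous_iff.1 (hcEq t) ε hε
  obtain ⟨δ₂, hδ₂, h₂⟩ := exists_dist_subjHist_lt hfEq hScpt t δ₁ hδ₁
  obtain ⟨δ₃, hδ₃, h₃⟩ := exists_dist_subjHist_lt hfEq hScpt (t + 1) δ₁ hδ₁
  refine ⟨min δ₁ (min δ₂ δ₃), by positivity, fun i si Z Z' ωi hZ => ?_⟩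
  simp only [lt_min_iff] at hZ
  have hx := h₂ i si Z Z' ωi fun k hk => (hZ k (by omega)).2.1
  have hu := h₃ i si Z Z' ωi fun k hk => (hZ k hk).2.2
  rw [Prod.dist_eq, max_lt_iff] at hx hu
  refine h₁ (_, _, _) (_, _, _) ?_ i
  simp only [Prod.dist_eq, max_lt_iff]
  exact ⟨(dist_le_pi_dist _ _ _).trans_lt hx.1, (dist_le_pi_dist _ _ _).trans_lt hu.2,
    (hZ t (by omega)).1⟩

variable [MetricSpace X0] [MetricSpace W0] [MetricSpace Ξ] [MetricSpace D]
variable {dstat : (N : ℕ) → ℕ → (Fin N → X) → (Fin N → U) → D}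
  {g : ℕ → X0 → D → Ξ → Y} {f0 : ℕ → X0 → D → W0 → X0}

/-- A unilateral change of one DM's strategy and primitive randomness has a vanishing effect on
the environment and on all other DMs, uniformly over the profiles and over the DM. -/
lemma exists_dist_sysHist_lt
    (hg : ∀ t, UniformContinuous fun p : X0 × D × Ξ => g t p.1 p.2.1 p.2.2)
    (hf0 : ∀ t, UniformContinuous fun p : X0 × D × W0 => f0 t p.1 p.2.1 p.2.2)
    (hfEq : ∀ t, UniformEquicontinuous fun (i : ℕ) (p : X × U × Y × W) =>
      f i t p.1 p.2.1 p.2.2.1 p.2.2.2)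
    (hScpt : ∀ t, IsCompact (Sset t))
    (hd1 : ∀ (t : ℕ) (ε : ℝ), 0 < ε → ∃ δ : ℝ, 0 < δ ∧
      ∀ (N : ℕ) (x u x' u'),
        (∀ i : Fin N, dist ((x i, u i) : X × U) (x' i, u' i) < δ) →
        dist (dstat N t x u) (dstat N t x' u') < ε)
    (hd2 : ∀ (t : ℕ) (ε : ℝ), 0 < ε → ∃ N0 : ℕ, ∀ N ≥ N0, ∀ (i : Fin N) (x u x' u'),
      (∀ j, j ≠ i → x j = x' j ∧ u j = u' j) → dist (dstat N t x u) (dstat N t x' u') < ε)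
    (t : ℕ) :
    ∀ ε > 0, ∃ N0 : ℕ, ∀ N ≥ N0, ∀ (i : Fin N) (s s' : Fin N → Strat X U Y Sset)
      (ω0 : Prim0 X0 W0 Ξ) (ω ω' : Fin N → PrimLoc X W),
      (∀ j, j ≠ i → s j = s' j ∧ ω j = ω' j) →
        (∀ j, j ≠ i → dist ((sysHist f dstat g f0 s (ω0, ω) t).1 j)
          ((sysHist f dstat g f0 s' (ω0, ω') t).1 j) < ε) ∧
        dist (sysHist f dstat g f0 s (ω0, ω) t).2 (sysHist f dstat g f0 s' (ω0, ω') t).2 < ε := by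
  induction t with
  | zero =>
    intro ε hε
    refine ⟨0, fun N _ i s s' ω0 ω ω' h => ⟨fun j hj => ?_, ?_⟩⟩
    · simpa [sysHist, (h j hj).2] using hε
    · simpa [sysHist] using hε
  | succ t ih =>
    intro ε hε
    obtain ⟨δf, hδf, hf⟩ := Metric.uniformEquicontinuous_iff.1 (hfEq t) ε hε
    obtain ⟨δg, hδg, hg⟩ := Metric.uniformContinuous_iff.1 (hg t) (min ε δf) (by positivity)
    obtain ⟨δ0, hδ0, hf0⟩ := Metric.uniformContinuous_iff.1 (hf0 t) ε hε
    obtain ⟨δd, hδd, hd⟩ := hd1 t (min δg δ0 / 2) (by positivity)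
    obtain ⟨Nd, hNd⟩ := hd2 t (min δg δ0 / 2) (by positivity)
    obtain ⟨δs, hδs, hs⟩ := exists_dist_strat_lt hScpt t
      (show 0 < min ε (min δf δd) by positivity)
    obtain ⟨Nh, hNh⟩ := ih (min ε (min δf (min δg (min δ0 (min δd δs))))) (by positivity)
    refine ⟨max Nd Nh, fun N hN i s s' ω0 ω ω' h => ?_⟩
    obtain ⟨hloc, henv⟩ := hNh N (le_of_max_le_right hN) i s s' ω0 ω ω' h
    set H := sysHist f dstat g f0 s (ω0, ω) t with hH
    set H' := sysHist f dstat g f0 s' (ω0, ω') t with hH'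
    set u : Fin N → U := fun j => (s j t).val ⟨(H.1 j).1, (H.1 j).2, H.2.1⟩ with hu
    set u' : Fin N → U := fun j => (s' j t).val ⟨(H'.1 j).1, (H'.1 j).2, H'.2.1⟩ with hu'
    set x : Fin N → X := fun j => (H.1 j).1 (Fin.last t) with hx
    set x' : Fin N → X := fun j => (H'.1 j).1 (Fin.last t) with hx'
    simp only [Prod.dist_eq, lt_min_iff, max_lt_iff] at hloc henv
    obtain ⟨⟨hy, hx0⟩, -, ⟨-, hx0g⟩, ⟨-, hx00⟩, -, hys, -⟩ := henv
    have huj : ∀ j, j ≠ i → dist (u j) (u' j) < ε ∧ dist (u j) (u' j) < δf ∧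
        dist (u j) (u' j) < δd := by
      intro j hj
      have := hs (s j t) ⟨(H.1 j).1, (H.1 j).2, H.2.1⟩ ⟨(H'.1 j).1, (H'.1 j).2, H'.2.1⟩ (by
        simp only [Prod.dist_eq, max_lt_iff]
        exact ⟨(hloc j hj).2.2.2.2.2.1, (hloc j hj).2.2.2.2.2.2, hys⟩)
      rw [lt_min_iff, lt_min_iff] at this
      simpa only [hu, hu', (h j hj).1] using this
    have hxj : ∀ j, j ≠ i → dist (x j) (x' j) < δf ∧ dist (x j) (x' j) < δd := fun j hj =>
      ⟨(dist_le_pi_dist (H.1 j).1 (H'.1 j).1 _).trans_lt (hloc j hj).2.1.1,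
        (dist_le_pi_dist (H.1 j).1 (H'.1 j).1 _).trans_lt (hloc j hj).2.2.2.2.1.1⟩
    have hdd : dist (dstat N t x u) (dstat N t x' u') < min δg δ0 := by
      have e₁ := hd N x u (Function.update x' i (x i)) (Function.update u' i (u i)) (by
        intro j
        by_cases hj : j = i
        · subst hj; simpa using hδd
        · simpa [hj, Prod.dist_eq] using ⟨(hxj j hj).2, (huj j hj).2.2⟩)
      have e₂ := hNd N (le_of_max_le_left hN) i (Function.update x' i (x i))
        (Function.update u' i (u i)) x' u' (fun j hj => by simp [hj])
      linarith [dist_triangle (dstat N t x u)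
        (dstat N t (Function.update x' i (x i)) (Function.update u' i (u i))) (dstat N t x' u')]
    rw [lt_min_iff] at hdd
    have hyt : dist (g t H.2.2 (dstat N t x u) (ω0.2.2 t))
        (g t H'.2.2 (dstat N t x' u') (ω0.2.2 t)) < min ε δf :=
      hg (a := (_, _, _)) (b := (_, _, _)) (by
        simp only [Prod.dist_eq, max_lt_iff, dist_self]
        exact ⟨hx0g, hdd.1, hδg⟩)
    rw [lt_min_iff] at hyt
    refine ⟨fun j hj => ?_, ?_⟩
    · simp only [sysHist, Prod.dist_eq, max_lt_iff]
      refine ⟨dist_finSnoc_lt (hloc j hj).1.1 (hf (_, _, _, _) (_, _, _, _) ?_ j),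
        dist_finSnoc_lt (hloc j hj).1.2 (huj j hj).1⟩
      simp only [Prod.dist_eq, max_lt_iff, (h j hj).2, dist_self]
      exact ⟨(hxj j hj).1, (huj j hj).2.1, hyt.2, hδf⟩
    · simp only [sysHist, Prod.dist_eq, max_lt_iff]
      refine ⟨dist_finSnoc_lt hy hyt.1, hf0 (a := (_, _, _)) (b := (_, _, _)) ?_⟩
      simp only [Prod.dist_eq, max_lt_iff, dist_self]
      exact ⟨hx00, hdd.2, hδ0⟩

end Deterministic

section MeasurePreserving

lemma bind_map_eq_map_prod {α β δ : Type*} [MeasurableSpace α] [MeasurableSpace β]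
    [MeasurableSpace δ] (μ : Measure α) (ν : Measure β) [SFinite ν] {F : α × β → δ}
    (hF : Measurable F) :
    μ.bind (fun a => ν.map fun b => F (a, b)) = (μ.prod ν).map F := by
  have hmeas : Measurable fun a => ν.map fun b => F (a, b) := by
    have : (fun a => ν.map fun b => F (a, b)) = fun a => (ν.map (Prod.mk a)).map F := by
      ext1 a
      rw [Measure.map_map hF measurable_prodMk_left]
      rfl
    rw [this]
    exact (Measure.measurable_map F hF).comp Measurable.map_prodMk_left
  ext s hs
  rw [Measure.bind_apply hs hmeas.aemeasurable, Measure.map_apply hF hs,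
    Measure.prod_apply (hF hs)]
  refine lintegral_congr fun a => ?_
  exact Measure.map_apply (hF.comp measurable_prodMk_left) hs

variable {ι : Type*} [Fintype ι] [DecidableEq ι]

/-- Resampling one coordinate of a product measure replaces the corresponding marginal. -/
lemma measurePreserving_update {α : Type*} [MeasurableSpace α] (μ μ' : ι → Measure α)
    [∀ j, IsProbabilityMeasure (μ j)] [∀ j, IsProbabilityMeasure (μ' j)] (i : ι)
    (h : ∀ j, j ≠ i → μ' j = μ j) :
    MeasurePreserving (fun p : α × (ι → α) => Function.update p.2 i p.1)
      ((μ' i).prod (Measure.pi μ)) (Measure.pi μ') := by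
  have hm : Measurable fun p : α × (ι → α) => Function.update p.2 i p.1 := by
    refine measurable_pi_lambda _ fun j => ?_
    by_cases hj : j = i
    · subst hj; simpa using measurable_fst
    · simp only [Function.update_of_ne hj]
      exact (measurable_pi_apply j).comp measurable_snd
  refine ⟨hm, (Measure.pi_eq fun s hs => ?_).symm⟩
  rw [Measure.map_apply hm (MeasurableSet.univ_pi hs)]
  have hpre : (fun p : α × (ι → α) => Function.update p.2 i p.1) ⁻¹' Set.univ.pi s
      = s i ×ˢ Set.univ.pi (Function.update s i Set.univ) := by
    ext p
    simp only [Set.mem_preimage, Set.mem_univ_pi, Set.mem_prod]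
    refine ⟨fun hp => ⟨by simpa using hp i, fun j => ?_⟩, fun hp j => ?_⟩
    · by_cases hj : j = i
      · subst hj; simp
      · simpa [hj] using hp j
    · by_cases hj : j = i
      · subst hj; simpa using hp.1
      · simpa [hj] using hp.2 j
  rw [hpre, Measure.prod_prod, Measure.pi_pi, ← Finset.mul_prod_erase _ _ (Finset.mem_univ i),
    ← Finset.mul_prod_erase Finset.univ (fun j => μ' j (s j)) (Finset.mem_univ i)]
  simp only [Function.update_self, measure_univ, one_mul]
  congr 1
  refine Finset.prod_congr rfl fun j hj => ?_
  have hji := Finset.ne_of_mem_erase hj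
  rw [Function.update_of_ne hji, h j hji]

lemma measurePreserving_update_update {S E A : Type*} [MeasurableSpace S] [MeasurableSpace E]
    [MeasurableSpace A] (γ γ' : ι → Measure S) (μ0 : Measure E) (m : ι → Measure A)
    [∀ j, IsProbabilityMeasure (γ j)] [∀ j, IsProbabilityMeasure (γ' j)]
    [IsProbabilityMeasure μ0] [∀ j, IsProbabilityMeasure (m j)] (i : ι)
    (h : ∀ j, j ≠ i → γ' j = γ j) :
    MeasurePreserving
      (fun p : S × (((ι → S) × (E × (ι → A))) × A) =>
        (Function.update p.2.1.1 i p.1, (p.2.1.2.1, Function.update p.2.1.2.2 i p.2.2)))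
      ((γ' i).prod (((Measure.pi γ).prod (μ0.prod (Measure.pi m))).prod (m i)))
      ((Measure.pi γ').prod (μ0.prod (Measure.pi m))) := by
  have hA := (MeasurePreserving.id (γ' i)).prod (measurePreserving_prodAssoc (Measure.pi γ)
    (μ0.prod (Measure.pi m)) (m i))
  have hB := (measurePreserving_prodAssoc (γ' i) (Measure.pi γ)
    ((μ0.prod (Measure.pi m)).prod (m i))).symm
  have hω := (((MeasurePreserving.id μ0).prod ((measurePreserving_update m m i
    fun _ _ => rfl).comp (Measure.measurePreserving_swap (μ := Measure.pi m) (ν := m i)))).comp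
      (measurePreserving_prodAssoc μ0 (Measure.pi m) (m i)))
  exact (((measurePreserving_update γ γ' i h).prod hω).comp hB).comp hA

/-- Comparison of a payoff evaluated against an independent copy of an environment `y` generated by
all coordinates with the payoff evaluated against the environment generated jointly with
coordinate `i`, under a uniform bound on the effect of resampling that coordinate. -/
lemma abs_integral_decoupled_sub_le {S E A V : Type*} [MeasurableSpace S] [MeasurableSpace E]
    [MeasurableSpace A] [MeasurableSpace V]
    (γ γ' : ι → Measure S) (μ0 : Measure E) (m : ι → Measure A)
    [∀ j, IsProbabilityMeasure (γ j)] [∀ j, IsProbabilityMeasure (γ' j)]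
    [IsProbabilityMeasure μ0] [∀ j, IsProbabilityMeasure (m j)] (i : ι)
    (h : ∀ j, j ≠ i → γ' j = γ j)
    {y : (ι → S) → E × (ι → A) → V} (hy : Measurable fun p : (ι → S) × (E × (ι → A)) => y p.1 p.2)
    {C : S → V → A → ℝ} (hC : Measurable fun p : S × V × A => C p.1 p.2.1 p.2.2)
    {B ε : ℝ} (hB : ∀ s v a, ‖C s v a‖ ≤ B)
    (hε : ∀ si s ω0 ω a, |C si (y s (ω0, ω)) a
      - C si (y (Function.update s i si) (ω0, Function.update ω i a)) a| ≤ ε) :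
    |(∫ si, ∫ v, ∫ a, C si v a ∂(m i)
        ∂((Measure.pi γ).bind fun s => (μ0.prod (Measure.pi m)).map (y s)) ∂(γ' i))
      - ∫ s, ∫ ω, C (s i) (y s ω) (ω.2 i) ∂(μ0.prod (Measure.pi m)) ∂(Measure.pi γ')| ≤ ε := by
  have hG₁ : Measurable fun q : S × (((ι → S) × (E × (ι → A))) × A) =>
      C q.1 (y q.2.1.1 q.2.1.2) q.2.2 :=
    hC.comp (measurable_fst.prodMk ((hy.comp measurable_snd.fst).prodMk measurable_snd.snd))
  have hG₂ : Measurable fun p : (ι → S) × (E × (ι → A)) => C (p.1 i) (y p.1 p.2) (p.2.2 i) :=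
    hC.comp (((measurable_pi_apply i).comp measurable_fst).prodMk
      (hy.prodMk ((measurable_pi_apply i).comp measurable_snd.snd)))
  have hmp := measurePreserving_update_update γ γ' μ0 m i h
  have hI₁ : Integrable (fun q : S × (((ι → S) × (E × (ι → A))) × A) =>
      C q.1 (y q.2.1.1 q.2.1.2) q.2.2)
      ((γ' i).prod (((Measure.pi γ).prod (μ0.prod (Measure.pi m))).prod (m i))) :=
    Integrable.of_bound hG₁.aestronglyMeasurable B (Filter.Eventually.of_forall fun _ => hB _ _ _)
  have hI₂ : Integrable (fun p : (ι → S) × (E × (ι → A)) => C (p.1 i) (y p.1 p.2) (p.2.2 i))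
      ((Measure.pi γ').prod (μ0.prod (Measure.pi m))) :=
    Integrable.of_bound hG₂.aestronglyMeasurable B (Filter.Eventually.of_forall fun _ => hB _ _ _)
  have hI₂' := hmp.integrable_comp_of_integrable hI₂
  have e₁ : (∫ si, ∫ v, ∫ a, C si v a ∂(m i)
        ∂((Measure.pi γ).bind fun s => (μ0.prod (Measure.pi m)).map (y s)) ∂(γ' i))
      = ∫ q, C q.1 (y q.2.1.1 q.2.1.2) q.2.2
        ∂((γ' i).prod (((Measure.pi γ).prod (μ0.prod (Measure.pi m))).prod (m i))) := by
    rw [bind_map_eq_map_prod (Measure.pi γ) (μ0.prod (Measure.pi m)) hy, integral_prod _ hI₁]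
    refine integral_congr_ae (Filter.Eventually.of_forall fun si => ?_)
    have hCs : Measurable fun p : V × A => C si p.1 p.2 := hC.comp measurable_prodMk_left
    dsimp only
    have hI : Integrable (fun r : ((ι → S) × (E × (ι → A))) × A => C si (y r.1.1 r.1.2) r.2)
        (((Measure.pi γ).prod (μ0.prod (Measure.pi m))).prod (m i)) :=
      Integrable.of_bound (hG₁.comp measurable_prodMk_left).aestronglyMeasurable B
        (Filter.Eventually.of_forall fun _ => hB _ _ _)
    rw [integral_map hy.aemeasurable hCs.stronglyMeasurable.integral_prod_right.aestronglyMeasurable,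
      integral_prod _ hI]
  have e₂ : (∫ s, ∫ ω, C (s i) (y s ω) (ω.2 i) ∂(μ0.prod (Measure.pi m)) ∂(Measure.pi γ'))
      = ∫ q, C q.1 (y (Function.update q.2.1.1 i q.1)
          (q.2.1.2.1, Function.update q.2.1.2.2 i q.2.2)) q.2.2
        ∂((γ' i).prod (((Measure.pi γ).prod (μ0.prod (Measure.pi m))).prod (m i))) := by
    rw [← integral_prod (fun p : (ι → S) × (E × (ι → A)) => C (p.1 i) (y p.1 p.2) (p.2.2 i)) hI₂,
      ← hmp.map_eq, integral_map hmp.aemeasurable hG₂.aestronglyMeasurable]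
    simp only [Function.update_self]
  simp only [Function.comp_def, Function.update_self] at hI₂'
  rw [e₁, e₂, ← integral_sub hI₁ hI₂', ← Real.norm_eq_abs]
  refine (norm_integral_le_of_norm_le_const
    (μ := (γ' i).prod (((Measure.pi γ).prod (μ0.prod (Measure.pi m))).prod (m i)))
    (Filter.Eventually.of_forall fun q => hε _ _ _ _ _)).trans ?_
  simp

end MeasurePreserving

instance instBorelSpaceContinuousMap (A B : Type) [TopologicalSpace A] [TopologicalSpace B] :
    BorelSpace C(A, B) := ⟨rfl⟩

section PathCost

variable {X U W Y : Type}
variable {f : ℕ → ℕ → X → U → Y → W → X} {c : ℕ → ℕ → X → U → Y → ℝ} {β : ℕ → ℝ}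
  {cbar βbar : ℝ}

lemma abs_discounted_le (hcb : ∀ i t x u y, |c i t x u y| ≤ cbar)
    (hβ0 : ∀ i, 0 ≤ β i) (hβb : ∀ i, β i ≤ βbar) (i t : ℕ) (x : X) (u : U) (y : Y) :
    ‖β i ^ t * c i t x u y‖ ≤ βbar ^ t * cbar := by
  rw [Real.norm_eq_abs, abs_mul, abs_of_nonneg (pow_nonneg (hβ0 i) t)]
  exact mul_le_mul (pow_le_pow_left₀ (hβ0 i) (hβb i) t) (hcb ..) (abs_nonneg _)
    (pow_nonneg ((hβ0 i).trans (hβb i)) t)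

lemma summable_discounted (hβ0 : ∀ i, 0 ≤ β i) (hβb : ∀ i, β i ≤ βbar) (hβbar : βbar < 1) :
    Summable fun t : ℕ => βbar ^ t * cbar :=
  (summable_geometric_of_lt_one ((hβ0 0).trans (hβb 0)) hβbar).mul_right _

lemma abs_pathCost_le [TopologicalSpace X] [TopologicalSpace U] [TopologicalSpace Y]
    {Sset : ∀ t : ℕ, Set C(Hist X U Y t, U)}
    (hcb : ∀ i t x u y, |c i t x u y| ≤ cbar)
    (hβ0 : ∀ i, 0 ≤ β i) (hβb : ∀ i, β i ≤ βbar) (hβbar : βbar < 1)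
    (i : ℕ) (si : Strat X U Y Sset) (Z : ℕ → Y) (ωi : PrimLoc X W) :
    ‖pathCost f c β i si Z ωi‖ ≤ ∑' t : ℕ, βbar ^ t * cbar :=
  tsum_of_norm_bounded (summable_discounted hβ0 hβb hβbar).hasSum
    fun t => abs_discounted_le hcb hβ0 hβb i t _ _ _

variable [MetricSpace X] [CompactSpace X] [MetricSpace U] [CompactSpace U]
  [MetricSpace W] [MetricSpace Y] [CompactSpace Y]
variable {Sset : ∀ t : ℕ, Set C(Hist X U Y t, U)}

lemma continuous_pathCost {i : ℕ}
    (hf : ∀ t, Continuous fun p : X × U × Y × W => f i t p.1 p.2.1 p.2.2.1 p.2.2.2)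
    (hc : ∀ t, Continuous fun p : X × U × Y => c i t p.1 p.2.1 p.2.2)
    (hcb : ∀ i t x u y, |c i t x u y| ≤ cbar)
    (hβ0 : ∀ i, 0 ≤ β i) (hβb : ∀ i, β i ≤ βbar) (hβbar : βbar < 1) :
    Continuous fun p : Strat X U Y Sset × (ℕ → Y) × PrimLoc X W =>
      pathCost f c β i p.1 p.2.1 p.2.2 := by
  refine continuous_tsum (fun t => ?_) (summable_discounted hβ0 hβb hβbar)
    fun t p => abs_discounted_le hcb hβ0 hβb i t _ _ _
  refine continuous_const.mul ((hc t).comp (Continuous.prodMk ?_ (Continuous.prodMk ?_ ?_)))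
  · exact (continuous_apply _).comp (continuous_subjHist hf t).fst
  · exact (continuous_apply (A := fun _ : Fin (t + 1) => U) (Fin.last t)).comp
      (continuous_subjHist hf (t + 1)).snd
  · fun_prop

/-- Pathwise costs merge along any family of pairs of environment sequences merging
coordinatewise, uniformly over DMs, strategies and local randomness. -/
lemma tendsto_pathCost_sub
    (hfEq : ∀ t, UniformEquicontinuous fun (i : ℕ) (p : X × U × Y × W) =>
      f i t p.1 p.2.1 p.2.2.1 p.2.2.2)
    (hcEq : ∀ t, UniformEquicontinuous fun (i : ℕ) (p : X × U × Y) => c i t p.1 p.2.1 p.2.2)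
    (hScpt : ∀ t, IsCompact (Sset t))
    (hcb : ∀ i t x u y, |c i t x u y| ≤ cbar)
    (hβ0 : ∀ i, 0 ≤ β i) (hβb : ∀ i, β i ≤ βbar) (hβbar : βbar < 1)
    {α : Type*} {l : Filter α} (i : α → ℕ) (si : α → Strat X U Y Sset) (Z Z' : α → ℕ → Y)
    (ωi : α → PrimLoc X W) (hZ : ∀ k, ∀ δ > 0, ∀ᶠ a in l, dist (Z a k) (Z' a k) < δ) :
    Filter.Tendsto (fun a => pathCost f c β (i a) (si a) (Z a) (ωi a)
      - pathCost f c β (i a) (si a) (Z' a) (ωi a)) l (nhds 0) := by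
  have hsum : ∀ a (Z : ℕ → Y), Summable fun t : ℕ => β (i a) ^ t *
      c (i a) t ((subjHist f (i a) (si a) Z (ωi a) t).1 (Fin.last t))
        ((subjHist f (i a) (si a) Z (ωi a) (t + 1)).2 (Fin.last t)) (Z t) := fun a Z =>
    Summable.of_norm_bounded (summable_discounted hβ0 hβb hβbar)
      fun t => abs_discounted_le hcb hβ0 hβb _ t _ _ _
  have hsub := fun a => (hsum a (Z a)).tsum_sub (hsum a (Z' a))
  simp only [pathCost, ← hsub]
  rw [← tsum_zero (β := ℕ)]
  refine tendsto_tsum_of_dominated_convergence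
    ((summable_discounted (cbar := cbar) hβ0 hβb hβbar).add
      (summable_discounted (cbar := cbar) hβ0 hβb hβbar)) (fun t => ?_)
    (Filter.Eventually.of_forall fun a t => (norm_sub_le _ _).trans
      (add_le_add (abs_discounted_le hcb hβ0 hβb _ t _ _ _)
        (abs_discounted_le hcb hβ0 hβb _ t _ _ _)))
  rw [Metric.tendsto_nhds]
  intro ε hε
  obtain ⟨δ, hδ, h⟩ := exists_dist_stageCost_lt hfEq hcEq hScpt t hε
  have hev : ∀ᶠ a in l, ∀ k ∈ Finset.range (t + 1), dist (Z a k) (Z' a k) < δ :=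
    (Filter.eventually_all_finset _).2 fun k _ => hZ k δ hδ
  filter_upwards [hev] with a ha
  have hd := h (i a) (si a) (Z a) (Z' a) (ωi a) fun k hk => ha k (Finset.mem_range.2 hk)
  rw [Real.dist_eq] at hd
  rw [dist_zero_right, Real.norm_eq_abs, ← mul_sub, abs_mul,
    abs_of_nonneg (pow_nonneg (hβ0 _) t)]
  exact (mul_le_of_le_one_left (abs_nonneg _)
    (pow_le_one₀ (hβ0 _) ((hβb _).trans hβbar.le))).trans_lt hd

end PathCost

end SEBEULarge

open SEBEULarge in
theorem subjective_and_objective_costs_uniformly_close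
    (X U W X0 W0 Ξ Y D : Type)
    [MetricSpace X] [CompactSpace X] [Nonempty X]
    [MetricSpace U] [CompactSpace U] [Nonempty U]
    [MetricSpace W] [CompactSpace W] [Nonempty W]
    [MetricSpace X0] [CompactSpace X0] [Nonempty X0]
    [MetricSpace W0] [CompactSpace W0] [Nonempty W0]
    [MetricSpace Ξ] [CompactSpace Ξ] [Nonempty Ξ]
    [MetricSpace Y] [CompactSpace Y] [Nonempty Y]
    [MetricSpace D] [CompactSpace D] [Nonempty D]
    [MeasurableSpace X] [BorelSpace X] [MeasurableSpace U] [BorelSpace U]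
    [MeasurableSpace W] [BorelSpace W] [MeasurableSpace X0] [BorelSpace X0]
    [MeasurableSpace W0] [BorelSpace W0] [MeasurableSpace Ξ] [BorelSpace Ξ]
    [MeasurableSpace Y] [BorelSpace Y]
    (f : ℕ → ℕ → X → U → Y → W → X)
    (dstat : (N : ℕ) → ℕ → (Fin N → X) → (Fin N → U) → D)
    (g : ℕ → X0 → D → Ξ → Y) (f0 : ℕ → X0 → D → W0 → X0)
    (c : ℕ → ℕ → X → U → Y → ℝ) (β : ℕ → ℝ)
    -- Assumption 4.1, Condition 1: Assumption 3.1 in all games, strengthened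
    (hf : ∀ i t, Continuous fun p : X × U × Y × W => f i t p.1 p.2.1 p.2.2.1 p.2.2.2)
    (hg : ∀ t, Continuous fun p : X0 × D × Ξ => g t p.1 p.2.1 p.2.2)
    (hf0 : ∀ t, Continuous fun p : X0 × D × W0 => f0 t p.1 p.2.1 p.2.2)
    (hc : ∀ i t, Continuous fun p : X × U × Y => c i t p.1 p.2.1 p.2.2)
    (hcEq : ∀ t, UniformEquicontinuous fun (i : ℕ) (p : X × U × Y) => c i t p.1 p.2.1 p.2.2)
    (hfEq : ∀ t, UniformEquicontinuous fun (i : ℕ) (p : X × U × Y × W) =>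
      f i t p.1 p.2.1 p.2.2.1 p.2.2.2)
    (Sset : ∀ t : ℕ, Set C(Hist X U Y t, U))
    (hScpt : ∀ t, IsCompact (Sset t)) (hSne : ∀ t, (Sset t).Nonempty)
    (cbar βbar : ℝ) (hcb : ∀ i t x u y, |c i t x u y| ≤ cbar)
    (hβ0 : ∀ i, 0 ≤ β i) (hβb : ∀ i, β i ≤ βbar) (hβbar : βbar < 1)
    -- Assumption 4.1, Condition 2: negligible-impact conditions on the aggregates
    (hd1 : ∀ (t : ℕ) (ε : ℝ), 0 < ε → ∃ δ : ℝ, 0 < δ ∧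
      ∀ (N : ℕ) (x u x' u'),
        (∀ i : Fin N, dist ((x i, u i) : X × U) (x' i, u' i) < δ) →
        dist (dstat N t x u) (dstat N t x' u') < ε)
    (hd2 : ∀ (t : ℕ) (ε : ℝ), 0 < ε →
      Filter.Tendsto
        (fun N : ℕ => ⨆ (i : Fin N) (x : Fin N → X) (u : Fin N → U)
            (x' : Fin N → X) (u' : Fin N → U)
            (_ : ∀ j : Fin N, j ≠ i → x j = x' j ∧ u j = u' j),
          dist (dstat N t x u) (dstat N t x' u'))
        Filter.atTop (nhds 0))
    -- Assumption 4.1, Condition 3: the primitive random variables are mutually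
    -- independent (built into `jointLaw`, the product of `μ0` and the `μloc i`)
    (μ0 : Measure (Prim0 X0 W0 Ξ)) (μloc : ℕ → Measure (PrimLoc X W))
    [IsProbabilityMeasure μ0] [∀ i, IsProbabilityMeasure (μloc i)] :
    -- conclusion: lim_{N→∞} sup_{i ∈ [1,N], γ̃ᶦ ∈ Γᶦ, γ ∈ Γ}
    --   |E^{(γ̃ᶦ, ζ_γ)}[Jᶦ] - E^{(γ̃ᶦ, γ^{-i})}[J̄^{i,N}]| = 0
    ∀ ε : ℝ, 0 < ε → ∃ N0 : ℕ, ∀ N : ℕ, N0 ≤ N →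
      ∀ (i : Fin N) (γtil : ProbabilityMeasure (Strat X U Y Sset))
        (γ : Fin N → ProbabilityMeasure (Strat X U Y Sset)),
        |expSubjCost μloc f c β i.val γtil (envLawMixed μ0 μloc f dstat g f0 N γ) -
            expObjCost μ0 μloc f dstat g f0 c β i (Function.update γ i γtil)| ≤ ε := by
  have scX : SecondCountableTopology X := UniformSpace.secondCountable_of_separable X
  have scU : SecondCountableTopology U := UniformSpace.secondCountable_of_separable U
  have scW : SecondCountableTopology W := UniformSpace.secondCountable_of_separable W
  have scX0 : SecondCountableTopology X0 := UniformSpace.secondCountable_of_separable X0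
  have scW0 : SecondCountableTopology W0 := UniformSpace.secondCountable_of_separable W0
  have scΞ : SecondCountableTopology Ξ := UniformSpace.secondCountable_of_separable Ξ
  have scY : SecondCountableTopology Y := UniformSpace.secondCountable_of_separable Y
  have scS : ∀ t, SecondCountableTopology (Sset t) := fun t => inferInstance
  have bS : ∀ t, BorelSpace (Sset t) := fun t => inferInstance
  have bStrat : BorelSpace (Strat X U Y Sset) := Pi.borelSpace
  have hd : ∀ N t, Continuous fun p : (Fin N → X) × (Fin N → U) => dstat N t p.1 p.2 := by
    intro N t
    refine Metric.continuous_iff.2 fun p ε hε => ?_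
    obtain ⟨δ, hδ, h⟩ := hd1 t ε hε
    refine ⟨δ, hδ, fun q hq => h N _ _ _ _ fun j => ?_⟩
    rw [Prod.dist_eq, max_lt_iff] at hq ⊢
    exact ⟨(dist_le_pi_dist q.1 p.1 j).trans_lt hq.1, (dist_le_pi_dist q.2 p.2 j).trans_lt hq.2⟩
  have hinfl : ∀ (t : ℕ) (ε : ℝ), 0 < ε → ∃ N0 : ℕ, ∀ N ≥ N0, ∀ (i : Fin N) (x u x' u'),
      (∀ j, j ≠ i → x j = x' j ∧ u j = u' j) →
        dist (dstat N t x u) (dstat N t x' u') < ε := by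
    intro t ε hε
    obtain ⟨N0, hN0⟩ := Filter.eventually_atTop.1 ((hd2 t ε hε).eventually_lt_const hε)
    exact ⟨N0, fun N hN i x u x' u' h =>
      (le_iSup_influence (dstat N t) i x x' u u' h).trans_lt (hN0 N hN)⟩
  intro ε hε
  obtain ⟨N0, hN0⟩ : ∃ N0 : ℕ, ∀ N ≥ N0, ∀ (i : Fin N) (si : Strat X U Y Sset)
      (s : Fin N → Strat X U Y Sset) (ω0 : Prim0 X0 W0 Ξ) (ω : Fin N → PrimLoc X W)
      (ωi : PrimLoc X W),
      |pathCost f c β i si (yPath f dstat g f0 s (ω0, ω)) ωi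
        - pathCost f c β i si (yPath f dstat g f0 (Function.update s i si)
            (ω0, Function.update ω i ωi)) ωi| < ε := by
    have hT := tendsto_pathCost_sub (Sset := Sset) hfEq hcEq hScpt hcb hβ0 hβb hβbar
      (α := Σ N : ℕ, Fin N × Strat X U Y Sset × (Fin N → Strat X U Y Sset) × Prim0 X0 W0 Ξ ×
        (Fin N → PrimLoc X W) × PrimLoc X W)
      (l := Filter.comap Sigma.fst Filter.atTop)
      (fun a => a.2.1) (fun a => a.2.2.1)
      (fun a => yPath f dstat g f0 a.2.2.2.1 (a.2.2.2.2.1, a.2.2.2.2.2.1))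
      (fun a => yPath f dstat g f0 (Function.update a.2.2.2.1 a.2.1 a.2.2.1)
        (a.2.2.2.2.1, Function.update a.2.2.2.2.2.1 a.2.1 a.2.2.2.2.2.2))
      (fun a => a.2.2.2.2.2.2) (by
        intro k δ hδ
        obtain ⟨N0, h⟩ := exists_dist_sysHist_lt (Sset := Sset)
          (fun t => CompactSpace.uniformContinuous_of_continuous (hg t))
          (fun t => CompactSpace.uniformContinuous_of_continuous (hf0 t))
          hfEq hScpt hd1 hinfl (k + 1) δ hδ
        filter_upwards [Filter.preimage_mem_comap (Filter.mem_atTop N0)] with a ha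
        have hy := (h a.1 ha a.2.1 a.2.2.2.1 (Function.update a.2.2.2.1 a.2.1 a.2.2.1)
          a.2.2.2.2.1 a.2.2.2.2.2.1 (Function.update a.2.2.2.2.2.1 a.2.1 a.2.2.2.2.2.2)
          fun j hj => by simp [hj]).2
        rw [Prod.dist_eq, max_lt_iff] at hy
        exact (dist_le_pi_dist _ _ (Fin.last k)).trans_lt hy.1)
    obtain ⟨N0, h⟩ := Filter.eventually_atTop.1
      (Filter.eventually_comap.1 (Metric.tendsto_nhds.1 hT ε hε))
    refine ⟨N0, fun N hN i si s ω0 ω ωi => ?_⟩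
    have := h N hN ⟨N, i, si, s, ω0, ω, ωi⟩ rfl
    rwa [dist_zero_right, Real.norm_eq_abs] at this
  refine ⟨N0, fun N hN i γtil γ => ?_⟩
  have hybase : Continuous fun p : (Fin N → Strat X U Y Sset) ×
      (Prim0 X0 W0 Ξ × (Fin N → PrimLoc X W)) => yPath f dstat g f0 p.1 p.2 :=
    continuous_pi fun t => (continuous_apply (Fin.last t)).comp
      (continuous_sysHist hf hg hf0 hd N (t + 1)).snd.fst
  have hpc : Continuous fun p : Strat X U Y Sset × (ℕ → Y) × PrimLoc X W =>
      pathCost f c β i p.1 p.2.1 p.2.2 :=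
    continuous_pathCost (hf i) (hc i) hcb hβ0 hβb hβbar
  have hupd : ∀ j, j ≠ i → (Function.update γ i γtil j : Measure (Strat X U Y Sset)) = γ j :=
    fun j hj => by rw [Function.update_of_ne hj]
  have key := abs_integral_decoupled_sub_le
    (fun j => (γ j : Measure (Strat X U Y Sset)))
    (fun j => (Function.update γ i γtil j : Measure (Strat X U Y Sset))) μ0
    (fun j : Fin N => μloc j) i hupd hybase.measurable hpc.measurable
    (abs_pathCost_le hcb hβ0 hβb hβbar i)
    (fun si s ω0 ω ωi => (hN0 N hN i si s ω0 ω ωi).le)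
  simp only [Function.update_self, pathCost, subjHist_yPath] at key
  exact key
end

section
/- Rounding a probability vector to integer player counts: let N ∈ ℕ with N ≥ 1, n ∈ ℕ, and p_1,…,p_n ≥ 0 with Σ_{ℓ=1}^n p_ℓ = 1. Define k_0 := 0 and recursively k_ℓ := ⌊N·Σ_{j=1}^ℓ p_j + 1/2⌋ − Σ_{j=0}^{ℓ−1} k_j for ℓ ∈ [1,n]. Then: (a) k_ℓ ≥ 0 for all ℓ ∈ [1,n]; (b) Σ_{ℓ=1}^n k_ℓ = N; (c) if p_ℓ = 0 then k_ℓ = 0; and (d) max_{ℓ∈[1,n]} |k_ℓ/N − p_ℓ| ≤ 1/N. -/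
/-- Rounding a probability vector to integer player counts.  Let `N ≥ 1`,
`p 1, …, p n ≥ 0` with `∑_{ℓ=1}^n p ℓ = 1`, and define `k 0 = 0` and recursively
`k ℓ = ⌊N·∑_{j=1}^ℓ p j + 1/2⌋ - ∑_{j=0}^{ℓ-1} k j` for `ℓ ∈ [1,n]`.  Then
(a) `k ℓ ≥ 0`; (b) `∑_{ℓ=1}^n k ℓ = N`; (c) `p ℓ = 0 → k ℓ = 0`; and
(d) `max_ℓ |k ℓ / N - p ℓ| ≤ 1/N`. -/
theorem rounding_probability_vector (N n : ℕ) (hN : 1 ≤ N) (p : ℕ → ℝ)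
    (hp : ∀ ℓ ∈ Finset.Icc 1 n, 0 ≤ p ℓ)
    (hsum : ∑ ℓ ∈ Finset.Icc 1 n, p ℓ = 1)
    (k : ℕ → ℤ) (hk0 : k 0 = 0)
    (hk : ∀ ℓ ∈ Finset.Icc 1 n,
      k ℓ = ⌊(N : ℝ) * (∑ j ∈ Finset.Icc 1 ℓ, p j) + 1 / 2⌋ -
              ∑ j ∈ Finset.Icc 0 (ℓ - 1), k j) :
    (∀ ℓ ∈ Finset.Icc 1 n, 0 ≤ k ℓ) ∧
    (∑ ℓ ∈ Finset.Icc 1 n, k ℓ = N) ∧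
    (∀ ℓ ∈ Finset.Icc 1 n, p ℓ = 0 → k ℓ = 0) ∧
    (∀ ℓ ∈ Finset.Icc 1 n, |(k ℓ : ℝ) / N - p ℓ| ≤ 1 / N) := by
  have sum_eq_floor : ∀ m ≤ n, ∑ j ∈ Finset.Icc 0 m, k j =
      ⌊(N : ℝ) * (∑ j ∈ Finset.Icc 1 m, p j) + 1 / 2⌋ := by
    intro m hm
    rcases m with _ | m
    · norm_num [hk0]
    · have h := hk (m + 1) (Finset.mem_Icc.2 ⟨by omega, hm⟩)
      rw [Nat.add_sub_cancel] at h
      rw [Finset.sum_Icc_succ_top (by omega), h]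
      ring
  have eq_floor_sub : ∀ ℓ ∈ Finset.Icc 1 n, ∃ x : ℝ,
      k ℓ = ⌊x + N * p ℓ + 1 / 2⌋ - ⌊x + 1 / 2⌋ := by
    intro ℓ hℓ
    have h := hk ℓ hℓ
    obtain ⟨h1, hn⟩ := Finset.mem_Icc.1 hℓ
    obtain ⟨m, rfl⟩ := Nat.exists_eq_add_of_le' h1
    refine ⟨N * ∑ j ∈ Finset.Icc 1 m, p j, ?_⟩
    rwa [Nat.add_sub_cancel, sum_eq_floor m (by omega),
      Finset.sum_Icc_succ_top (by omega), mul_add] at h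
  have hN' : (0 : ℝ) < N := by exact_mod_cast hN
  refine ⟨fun ℓ hℓ => ?_, ?_, fun ℓ hℓ h0 => ?_, fun ℓ hℓ => ?_⟩
  · obtain ⟨x, hx⟩ := eq_floor_sub ℓ hℓ
    have := mul_nonneg hN'.le (hp ℓ hℓ)
    rw [hx, sub_nonneg]
    exact Int.floor_le_floor (by linarith)
  · have h := sum_eq_floor n le_rfl
    rw [hsum, mul_one, Int.floor_natCast_add, ← Finset.add_sum_Ioc_eq_sum_Icc n.zero_le, hk0,
      zero_add] at h
    norm_num at h
    exact h
  · obtain ⟨x, hx⟩ := eq_floor_sub ℓ hℓ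
    simpa [h0] using hx
  · obtain ⟨x, hx⟩ := eq_floor_sub ℓ hℓ
    have hdiff : (k ℓ : ℝ) / N - p ℓ = (k ℓ - N * p ℓ) / N := by field_simp
    rw [hdiff, abs_div, abs_of_pos hN']
    gcongr
    rw [hx, Int.cast_sub, abs_le]
    constructor <;>
      linarith [Int.floor_le (x + N * p ℓ + 1 / 2), Int.lt_floor_add_one (x + N * p ℓ + 1 / 2),
        Int.floor_le (x + 1 / 2), Int.lt_floor_add_one (x + 1 / 2)]
end
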